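/- Let r ≥ 2 be a fixed integer. For every ε > 0, the asymptotic formula ∑_{n ≤ x} d(𝓜_r(n)) = 𝓒(r,1)·x·ln x + (H₁′(1) + (2γ − 1)·𝓒(r,1))·x + O(x^{1/2+ε}) holds as x → ∞, where 𝓒(r,1) = (6ζ(r)/π²)·∏_p (1 − 1/(p^r + p^{r−1})) (product over all primes p) and H₁(s) = (ζ(rs)/ζ(2s))·∏_p (1 − 1/(p^{rs} + p^{(r−1)s})). -/

import Mathlib

open Filter Asymptotics

/-- The generalized minimal power function `𝓜_r(n) = min {m ∈ ℕ : n ∣ m^r}`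
(where `m` ranges over positive integers). -/
noncomputable def genMinPow (r n : ℕ) : ℕ := sInf {m : ℕ | 0 < m ∧ n ∣ m ^ r}

/-- The auxiliary function `H₁(s) = (ζ(rs)/ζ(2s)) · ∏_p (1 − 1/(p^{rs} + p^{(r−1)s}))`. -/
noncomputable def H1fun (r : ℕ) (s : ℂ) : ℂ :=
  (riemannZeta ((r : ℂ) * s) / riemannZeta (2 * s)) *
    ∏' p : Nat.Primes,
      (1 - 1 / (((p : ℕ) : ℂ) ^ ((r : ℂ) * s) + ((p : ℕ) : ℂ) ^ (((r : ℂ) - 1) * s)))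

/-- The leading coefficient `𝓒(r,1) = (6ζ(r)/π²) ∏_p (1 − 1/(p^r + p^{r−1}))`. -/
noncomputable def Cr1 (r : ℕ) : ℂ :=
  (6 * riemannZeta r / (Real.pi : ℂ) ^ 2) *
    ∏' p : Nat.Primes, (1 - 1 / (((p : ℕ) : ℂ) ^ r + ((p : ℕ) : ℂ) ^ (r - 1)))

theorem sum_div_eq_hyperbola (N : ℕ) :
    ∑ n ∈ Finset.Ioc 0 N, N / n + N.sqrt ^ 2 = 2 * ∑ n ∈ Finset.Ioc 0 N.sqrt, N / n := by
  set K := N.sqrt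
  have hKN : K * K ≤ N := Nat.sqrt_le N
  have hNK : N < (K + 1) * (K + 1) := Nat.lt_succ_sqrt N
  have hle : K ≤ N := Nat.sqrt_le_self N
  have key (M : ℕ) : ∑ n ∈ Finset.Ioc 0 M, N / n =
      ((Finset.Ioc 0 M).sigma fun n => Finset.Ioc 0 (N / n)).card := by
    simp [Finset.card_sigma]
  have mem (M : ℕ) (x : Σ _ : ℕ, ℕ) :
      x ∈ ((Finset.Ioc 0 M).sigma fun n => Finset.Ioc 0 (N / n)) ↔
        0 < x.1 ∧ x.1 ≤ M ∧ 0 < x.2 ∧ x.1 * x.2 ≤ N := by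
    simp only [Finset.mem_sigma, Finset.mem_Ioc, and_assoc]
    refine and_congr_right fun h => and_congr_right fun _ => and_congr_right fun _ => ?_
    rw [Nat.le_div_iff_mul_le h, mul_comm]
  set A := (Finset.Ioc 0 K).sigma fun n => Finset.Ioc 0 (N / n) with hA
  let e : (Σ _ : ℕ, ℕ) ↪ (Σ _ : ℕ, ℕ) :=
    ⟨fun x => ⟨x.2, x.1⟩, fun x y h => by
      simp only [Sigma.mk.injEq, heq_eq_eq] at h
      exact Sigma.ext h.2 (heq_of_eq h.1)⟩
  have hmemB (x : Σ _ : ℕ, ℕ) : x ∈ A.map e ↔ 0 < x.2 ∧ x.2 ≤ K ∧ 0 < x.1 ∧ x.2 * x.1 ≤ N := by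
    rw [Finset.mem_map]
    constructor
    · rintro ⟨y, hy, rfl⟩
      exact (mem K y).1 hy
    · intro h
      exact ⟨⟨x.2, x.1⟩, (mem K _).2 h, rfl⟩
  have hunion : ((Finset.Ioc 0 N).sigma fun n => Finset.Ioc 0 (N / n)) = A ∪ A.map e := by
    ext x
    rw [Finset.mem_union, mem, hmemB, hA, mem]
    constructor
    · rintro ⟨h1, -, h3, h4⟩
      by_cases h : x.1 ≤ K
      · exact Or.inl ⟨h1, h, h3, h4⟩
      · refine Or.inr ⟨h3, ?_, h1, by rwa [mul_comm]⟩
        by_contra h'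
        have := Nat.mul_le_mul (Nat.succ_le_of_lt (not_le.1 h)) (Nat.succ_le_of_lt (not_le.1 h'))
        simp only [Nat.succ_eq_add_one] at this
        omega
    · rintro (⟨h1, h2, h3, h4⟩ | ⟨h1, h2, h3, h4⟩)
      · exact ⟨h1, h2.trans hle, h3, h4⟩
      · exact ⟨h3, (Nat.le_mul_of_pos_left _ h1).trans h4, h1, by rwa [mul_comm]⟩
  have hinter : A ∩ A.map e = (Finset.Ioc 0 K).sigma fun _ => Finset.Ioc 0 K := by
    ext x
    rw [Finset.mem_inter, hmemB, hA, mem]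
    simp only [Finset.mem_sigma, Finset.mem_Ioc]
    constructor
    · rintro ⟨⟨h1, h2, h3, h4⟩, h5, h6, -⟩
      exact ⟨⟨h1, h2⟩, h3, h6⟩
    · rintro ⟨⟨h1, h2⟩, h3, h4⟩
      have h5 := (Nat.mul_le_mul h2 h4).trans hKN
      exact ⟨⟨h1, h2, h3, h5⟩, h3, h4, h1, by rwa [mul_comm]⟩
  have hcard := Finset.card_union_add_card_inter A (A.map e)
  rw [← hunion, hinter, Finset.card_map, ← key, hA, ← key] at hcard
  simp only [Finset.card_sigma, Nat.card_Ioc, Finset.sum_const, smul_eq_mul, tsub_zero] at hcard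
  rw [sq, hcard]
  ring

open Real in
theorem abs_harmonic_sub_log_sub_eulerMascheroniConstant_le {K : ℕ} (hK : 0 < K) :
    |(harmonic K : ℝ) - log K - eulerMascheroniConstant| ≤ 1 / K := by
  have h1 := eulerMascheroniSeq_lt_eulerMascheroniConstant K
  have h2 := eulerMascheroniConstant_lt_eulerMascheroniSeq' K
  have hK' : (0 : ℝ) < K := by exact_mod_cast hK
  have h3 : log (K + 1) - log K ≤ 1 / K := by
    rw [← log_div (by positivity) (by positivity)]
    refine (log_le_sub_one_of_pos (by positivity)).trans (le_of_eq ?_)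
    field_simp
    ring
  rw [eulerMascheroniSeq] at h1
  rw [eulerMascheroniSeq', if_neg hK.ne'] at h2
  rw [abs_le]
  constructor <;> linarith [show (0 : ℝ) ≤ 1 / K by positivity]

open Real in
theorem abs_sum_sigma_zero_sub_le_sqrt {y : ℝ} (hy : 1 ≤ y) :
    |((∑ n ∈ Finset.Ioc 0 ⌊y⌋₊, ArithmeticFunction.sigma 0 n : ℕ) : ℝ) -
      (y * log y + (2 * eulerMascheroniConstant - 1) * y)| ≤ 12 * √y := by
  have hy0 : 0 < y := by linarith
  set N := ⌊y⌋₊ with hN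
  set K := N.sqrt
  have hN1 : 1 ≤ N := Nat.le_floor (by simpa using hy)
  have hK1 : 1 ≤ K := Nat.le_sqrt.2 (by simpa using hN1)
  have hK1' : (1 : ℝ) ≤ K := by exact_mod_cast hK1
  set s := √y with hs
  have hs2 : s * s = y := mul_self_sqrt hy0.le
  have hs1 : 1 ≤ s := one_le_sqrt.2 hy
  have hKs : (K : ℝ) ≤ s := by
    apply le_sqrt_of_sq_le
    have h : ((K * K : ℕ) : ℝ) ≤ N := by exact_mod_cast Nat.sqrt_le N
    have h' : (N : ℝ) ≤ y := Nat.floor_le hy0.le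
    push_cast at h
    nlinarith
  have hsK : s < K + 1 := by
    rw [hs, sqrt_lt' (by positivity)]
    have h : ((N + 1 : ℕ) : ℝ) ≤ ((K + 1) * (K + 1) : ℕ) := by
      exact_mod_cast Nat.lt_succ_sqrt N
    have h' : y < N + 1 := Nat.lt_floor_add_one y
    push_cast at h
    nlinarith
  have hsum : ((∑ n ∈ Finset.Ioc 0 N, ArithmeticFunction.sigma 0 n : ℕ) : ℝ) =
      2 * (∑ n ∈ Finset.Ioc 0 K, ((N / n : ℕ) : ℝ)) - (K : ℝ) ^ 2 := by
    rw [ArithmeticFunction.sum_Ioc_sigma0_eq_sum_div, eq_sub_iff_add_eq]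
    exact_mod_cast sum_div_eq_hyperbola N
  have hharm : y * (harmonic K : ℝ) = ∑ n ∈ Finset.Ioc 0 K, y / n := by
    rw [harmonic_eq_sum_Icc, Rat.cast_sum, Finset.mul_sum]
    exact Finset.sum_congr rfl fun n _ => by simp [div_eq_mul_inv]
  have hfloor (n : ℕ) : ((N / n : ℕ) : ℝ) ≤ y / n ∧ y / n - 1 ≤ ((N / n : ℕ) : ℝ) := by
    rw [hN, ← Nat.floor_div_natCast]
    exact ⟨Nat.floor_le (by positivity), (Nat.sub_one_lt_floor _).le⟩
  have hup : ∑ n ∈ Finset.Ioc 0 K, ((N / n : ℕ) : ℝ) ≤ y * harmonic K := by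
    rw [hharm]
    exact Finset.sum_le_sum fun n _ => (hfloor n).1
  have hlow : y * harmonic K - K ≤ ∑ n ∈ Finset.Ioc 0 K, ((N / n : ℕ) : ℝ) := by
    have := Finset.sum_le_sum fun n (_ : n ∈ Finset.Ioc 0 K) => (hfloor n).2
    rw [Finset.sum_sub_distrib, ← hharm] at this
    simpa using this
  have hyK : y * (1 / K) ≤ 2 * s := by
    rw [mul_one_div, div_le_iff₀ (by positivity)]
    nlinarith
  have hγ : |y * (harmonic K : ℝ) - y * log K - y * eulerMascheroniConstant| ≤ 2 * s := by
    rw [← mul_sub, ← mul_sub, abs_mul, abs_of_pos hy0]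
    exact (mul_le_mul_of_nonneg_left
      (abs_harmonic_sub_log_sub_eulerMascheroniConstant_le hK1) hy0.le).trans hyK
  have hlog0 : log K ≤ log s := log_le_log (by positivity) hKs
  have hlog1 : log s - log K ≤ 1 / K := by
    rw [← log_div (by positivity) (by positivity)]
    refine (log_le_sub_one_of_pos (by positivity)).trans ?_
    rw [sub_le_iff_le_add, div_le_iff₀ (by positivity)]
    have : (1 / (K : ℝ) + 1) * K = 1 + K := by field_simp
    linarith
  have hlogy : log y = 2 * log s := by rw [← hs2, log_mul (by positivity) (by positivity)]; ring
  have hl : y * (log s - log K) ≤ 2 * s := (mul_le_mul_of_nonneg_left hlog1 hy0.le).trans hyK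
  have hl0 : 0 ≤ y * (log s - log K) := mul_nonneg hy0.le (by linarith)
  have hq1 : (K : ℝ) ^ 2 ≤ y := by nlinarith
  have hq2 : y - 2 * s ≤ (K : ℝ) ^ 2 := by nlinarith
  rw [hsum, hlogy]
  rw [abs_le] at hγ ⊢
  constructor <;> nlinarith [hγ.1, hγ.2]

open Real in
/-- The Dirichlet divisor estimate, uniform in all positive real arguments. -/
theorem exists_abs_sum_sigma_zero_sub_le_rpow {θ : ℝ} (hθ : 1 / 2 ≤ θ) (hθ1 : θ < 1) :
    ∃ C : ℝ, ∀ y : ℝ, 0 < y →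
      |((∑ n ∈ Finset.Ioc 0 ⌊y⌋₊, ArithmeticFunction.sigma 0 n : ℕ) : ℝ) -
        (y * log y + (2 * eulerMascheroniConstant - 1) * y)| ≤ C * y ^ θ := by
  refine ⟨12 + 1 / (1 - θ), fun y hy => ?_⟩
  have hθ' : 0 < 1 - θ := by linarith
  have hyθ : 0 < y ^ θ := rpow_pos_of_pos hy θ
  rcases le_or_gt 1 y with h | h
  · refine (abs_sum_sigma_zero_sub_le_sqrt h).trans ?_
    have h1 : √y ≤ y ^ θ := by
      rw [sqrt_eq_rpow]
      exact rpow_le_rpow_of_exponent_le h hθ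
    have : 0 ≤ 1 / (1 - θ) := by positivity
    nlinarith [sqrt_nonneg y]
  · have hfl : ⌊y⌋₊ = 0 := Nat.floor_eq_zero.2 h
    have hlog : log y⁻¹ ≤ y⁻¹ ^ (1 - θ) / (1 - θ) := log_le_rpow_div (by positivity) hθ'
    have hpow : y * y⁻¹ ^ (1 - θ) = y ^ θ := by
      rw [inv_rpow hy.le, ← rpow_neg hy.le]
      nth_rewrite 1 [← rpow_one y]
      rw [← rpow_add hy]
      congr 1
      ring
    have h1 : y * -log y ≤ 1 / (1 - θ) * y ^ θ := by
      rw [log_inv] at hlog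
      calc y * -log y ≤ y * (y⁻¹ ^ (1 - θ) / (1 - θ)) := mul_le_mul_of_nonneg_left hlog hy.le
        _ = 1 / (1 - θ) * y ^ θ := by rw [← hpow]; ring
    have h2 : y ≤ y ^ θ := by
      nth_rewrite 1 [← rpow_one y]
      exact rpow_le_rpow_of_exponent_ge hy h.le hθ1.le
    have h3 := one_half_lt_eulerMascheroniConstant
    have h4 := eulerMascheroniConstant_lt_two_thirds
    have h5 : y * log y ≤ 0 := mul_nonpos_of_nonneg_of_nonpos hy.le (log_nonpos hy.le h.le)
    rw [hfl]
    simp only [Finset.Ioc_self, Finset.sum_empty, Nat.cast_zero]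
    rw [abs_le]
    constructor <;> nlinarith

theorem genMinPow_eq_ceilRoot {r n : ℕ} (hr : r ≠ 0) (hn : n ≠ 0) :
    genMinPow r n = Nat.ceilRoot r n := by
  have h0 : 0 < Nat.ceilRoot r n := Nat.pos_of_ne_zero (Nat.ceilRoot_ne_zero.2 ⟨hr, hn⟩)
  have hmem : Nat.ceilRoot r n ∈ {m : ℕ | 0 < m ∧ n ∣ m ^ r} := ⟨h0, Nat.dvd_ceilRoot_pow hr⟩
  refine le_antisymm (Nat.sInf_le hmem) (le_csInf ⟨_, hmem⟩ ?_)
  rintro m ⟨hm, hdvd⟩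
  exact Nat.le_of_dvd hm ((Nat.dvd_pow_iff_ceilRoot_dvd hr).1 hdvd)

theorem Nat.ceilRoot_dvd_self {r : ℕ} (hr : r ≠ 0) (n : ℕ) : Nat.ceilRoot r n ∣ n :=
  (Nat.dvd_pow_iff_ceilRoot_dvd hr).1 (dvd_pow_self n hr)

theorem Nat.Coprime.ceilRoot_mul {r m n : ℕ} (hr : r ≠ 0) (h : m.Coprime n) :
    Nat.ceilRoot r (m * n) = Nat.ceilRoot r m * Nat.ceilRoot r n := by
  have hc : (Nat.ceilRoot r m).Coprime (Nat.ceilRoot r n) :=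
    Nat.Coprime.coprime_dvd_left (Nat.ceilRoot_dvd_self hr m)
      (Nat.Coprime.coprime_dvd_right (Nat.ceilRoot_dvd_self hr n) h)
  apply Nat.dvd_antisymm
  · rw [← Nat.dvd_pow_iff_ceilRoot_dvd hr, mul_pow]
    exact mul_dvd_mul (Nat.dvd_ceilRoot_pow hr) (Nat.dvd_ceilRoot_pow hr)
  · refine hc.mul_dvd_of_dvd_of_dvd ?_ ?_ <;> rw [← Nat.dvd_pow_iff_ceilRoot_dvd hr]
    · exact (_root_.dvd_mul_right m n).trans (Nat.dvd_ceilRoot_pow hr)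
    · exact (_root_.dvd_mul_left n m).trans (Nat.dvd_ceilRoot_pow hr)

theorem Nat.Prime.ceilRoot_pow {r p : ℕ} (hr : r ≠ 0) (hp : p.Prime) (k : ℕ) :
    Nat.ceilRoot r (p ^ k) = p ^ ((k + r - 1) / r) := by
  have hne : p ^ k ≠ 0 := pow_ne_zero _ hp.ne_zero
  refine Nat.eq_of_factorization_eq (Nat.ceilRoot_ne_zero.2 ⟨hr, hne⟩)
    (pow_ne_zero _ hp.ne_zero) fun q => ?_
  rw [Nat.factorization_ceilRoot, hp.factorization_pow, hp.factorization_pow,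
    Finsupp.ceilDiv_apply, Nat.ceilDiv_eq_add_pred_div]
  by_cases hq : p = q
  · simp [hq]
  · simp only [Finsupp.single_eq_of_ne (Ne.symm hq)]
    exact Nat.div_eq_of_lt (by omega)

/-- The arithmetic function `n ↦ d(𝓜_r(n))`. -/
def cardDivisorsCeilRoot (r : ℕ) : ArithmeticFunction ℂ :=
  ⟨fun n => ((Nat.ceilRoot r n).divisors.card : ℂ), by simp⟩

theorem cardDivisorsCeilRoot_apply (r n : ℕ) :
    cardDivisorsCeilRoot r n = ((Nat.ceilRoot r n).divisors.card : ℂ) := rfl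

theorem isMultiplicative_cardDivisorsCeilRoot {r : ℕ} (hr : r ≠ 0) :
    (cardDivisorsCeilRoot r).IsMultiplicative := by
  refine ⟨by simp [cardDivisorsCeilRoot_apply, hr], fun {m n} h => ?_⟩
  have hc : (Nat.ceilRoot r m).Coprime (Nat.ceilRoot r n) :=
    Nat.Coprime.coprime_dvd_left (Nat.ceilRoot_dvd_self hr m)
      (Nat.Coprime.coprime_dvd_right (Nat.ceilRoot_dvd_self hr n) h)
  simp only [cardDivisorsCeilRoot_apply]
  rw [h.ceilRoot_mul hr, hc.card_divisors_mul, Nat.cast_mul]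

theorem cardDivisorsCeilRoot_prime_pow {r p : ℕ} (hr : r ≠ 0) (hp : p.Prime) (k : ℕ) :
    cardDivisorsCeilRoot r (p ^ k) = ((k + r - 1) / r + 1 : ℕ) := by
  rw [cardDivisorsCeilRoot_apply, hp.ceilRoot_pow hr, Nat.divisors_prime_pow hp]
  simp

open ArithmeticFunction ArithmeticFunction.Moebius ArithmeticFunction.zeta in
theorem ArithmeticFunction.mul_moebius_prime_pow_succ (f : ArithmeticFunction ℂ) {p : ℕ}
    (hp : p.Prime) (k : ℕ) :
    (f * (μ : ArithmeticFunction ℂ)) (p ^ (k + 1)) = f (p ^ (k + 1)) - f (p ^ k) := by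
  have h (k : ℕ) : f (p ^ k) =
      ∑ i ∈ Finset.range (k + 1), (f * (μ : ArithmeticFunction ℂ)) (p ^ i) := by
    conv_lhs => rw [← mul_one f, ← coe_moebius_mul_coe_zeta, ← mul_assoc, coe_mul_zeta_apply]
    rw [Nat.sum_divisors_prime_pow hp]
  rw [h (k + 1), h k, Finset.sum_range_succ _ (k + 1)]
  ring

open ArithmeticFunction ArithmeticFunction.Moebius in
/-- The Dirichlet inverse transform `d(𝓜_r) * μ * μ`, whose Dirichlet series is `H₁`. -/
noncomputable def H1coeff (r : ℕ) : ArithmeticFunction ℂ :=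
  cardDivisorsCeilRoot r * (μ : ArithmeticFunction ℂ) * (μ : ArithmeticFunction ℂ)

section

variable {r : ℕ}

open ArithmeticFunction ArithmeticFunction.Moebius ArithmeticFunction.zeta in
theorem H1coeff_mul_sigma_zero (r : ℕ) :
    H1coeff r * ((sigma 0 : ArithmeticFunction ℕ) : ArithmeticFunction ℂ) =
      cardDivisorsCeilRoot r := by
  rw [← zeta_mul_pow_eq_sigma, pow_zero_eq_zeta, natCoe_mul, H1coeff]
  calc _ = cardDivisorsCeilRoot r * ((μ : ArithmeticFunction ℂ) * (ζ : ArithmeticFunction ℂ)) *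
        ((μ : ArithmeticFunction ℂ) * (ζ : ArithmeticFunction ℂ)) := by ring
    _ = _ := by rw [coe_moebius_mul_coe_zeta, mul_one, mul_one]

open ArithmeticFunction in
theorem isMultiplicative_mul_moebius {f : ArithmeticFunction ℂ} (hf : f.IsMultiplicative) :
    (f * ((moebius : ArithmeticFunction ℤ) : ArithmeticFunction ℂ)).IsMultiplicative :=
  hf.mul isMultiplicative_moebius.intCast

theorem isMultiplicative_H1coeff (hr : r ≠ 0) : (H1coeff r).IsMultiplicative :=
  isMultiplicative_mul_moebius
    (isMultiplicative_mul_moebius (isMultiplicative_cardDivisorsCeilRoot hr))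

open ArithmeticFunction ArithmeticFunction.Moebius in
theorem cardDivisorsCeilRoot_mul_moebius_prime_pow_succ (hr : r ≠ 0) {p : ℕ} (hp : p.Prime)
    (k : ℕ) :
    (cardDivisorsCeilRoot r * (μ : ArithmeticFunction ℂ)) (p ^ (k + 1)) =
      if r ∣ k then 1 else 0 := by
  rw [mul_moebius_prime_pow_succ _ hp, cardDivisorsCeilRoot_prime_pow hr hp,
    cardDivisorsCeilRoot_prime_pow hr hp]
  have h1 : (k + 1 + r - 1) / r = k / r + 1 := by
    rw [show k + 1 + r - 1 = k + r by omega, Nat.add_div_right _ (Nat.pos_of_ne_zero hr)]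
  have h2 : (k + r - 1) / r + (if r ∣ k then 1 else 0) = k / r + 1 := by
    obtain ⟨s, rfl⟩ : ∃ s, r = s + 1 := ⟨r - 1, by omega⟩
    split_ifs with h
    · obtain ⟨c, rfl⟩ := h
      rw [show (s + 1) * c + (s + 1) - 1 = s + (s + 1) * c by omega,
        Nat.add_mul_div_left _ _ (by omega), Nat.mul_div_cancel_left _ (by omega),
        Nat.div_eq_of_lt (by omega : s < s + 1)]
      omega
    · have hd := Nat.div_add_mod k (s + 1)
      have hlt := Nat.mod_lt k (by omega : s + 1 > 0)
      have hpos : 0 < k % (s + 1) := Nat.pos_of_ne_zero fun h' => h (Nat.dvd_of_mod_eq_zero h')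
      generalize k % (s + 1) = b at *
      generalize k / (s + 1) = c at *
      rw [add_zero]
      rw [show k + (s + 1) - 1 = k + s by omega]
      apply Nat.div_eq_of_lt_le <;> nlinarith
  rw [h1, ← h2]
  split_ifs <;> push_cast <;> ring

theorem H1coeff_prime (hr : 2 ≤ r) {p : ℕ} (hp : p.Prime) : H1coeff r p = 0 := by
  have h := ArithmeticFunction.mul_moebius_prime_pow_succ
    (cardDivisorsCeilRoot r * (ArithmeticFunction.moebius : ArithmeticFunction ℂ)) hp 0
  rw [cardDivisorsCeilRoot_mul_moebius_prime_pow_succ (by omega) hp, pow_zero, zero_add, pow_one,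
    (isMultiplicative_mul_moebius (isMultiplicative_cardDivisorsCeilRoot (by omega))).map_one] at h
  rw [H1coeff, h]
  simp

theorem norm_H1coeff_prime_pow_le (hr : 2 ≤ r) {p : ℕ} (hp : p.Prime) (k : ℕ) :
    ‖H1coeff r (p ^ k)‖ ≤ 1 := by
  rcases k with _ | _ | k
  · simp [(isMultiplicative_H1coeff (by omega : r ≠ 0)).map_one]
  · simp [H1coeff_prime hr hp]
  · rw [H1coeff, ArithmeticFunction.mul_moebius_prime_pow_succ _ hp,
      cardDivisorsCeilRoot_mul_moebius_prime_pow_succ (by omega) hp,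
      cardDivisorsCeilRoot_mul_moebius_prime_pow_succ (by omega) hp]
    split_ifs <;> simp

theorem norm_H1coeff_le (hr : 2 ≤ r) (n : ℕ) : ‖H1coeff r n‖ ≤ 1 := by
  rcases eq_or_ne n 0 with rfl | hn
  · simp
  rw [(isMultiplicative_H1coeff (by omega)).multiplicative_factorization _ hn, Finsupp.prod,
    norm_prod]
  exact Finset.prod_le_one (fun _ _ => norm_nonneg _) fun p hp =>
    norm_H1coeff_prime_pow_le hr (Nat.prime_of_mem_primeFactors hp) _

theorem Nat.exists_sq_mul_cube_eq {n : ℕ} (hn : n ≠ 0)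
    (h : ∀ p : ℕ, p.Prime → n.factorization p ≠ 1) : ∃ a b : ℕ, a ^ 2 * b ^ 3 = n := by
  obtain ⟨b, m, rfl, hb⟩ := Nat.sq_mul_squarefree n
  have hm : m ≠ 0 := by rintro rfl; simp at hn
  have hdvd : b ∣ m := by
    rw [← Nat.factorization_le_iff_dvd hb.ne_zero hm]
    intro p
    by_cases hp : p.Prime
    · have h1 := h p hp
      have h2 := hb.natFactorization_le_one p
      rw [Nat.factorization_mul (pow_ne_zero _ hm) hb.ne_zero, Nat.factorization_pow] at h1
      simp at h1
      omega
    · simp [Nat.factorization_eq_zero_of_not_prime _ hp]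
  obtain ⟨k, rfl⟩ := hdvd
  exact ⟨k, b, by ring⟩

theorem exists_sq_mul_cube_of_H1coeff_ne_zero (hr : 2 ≤ r) {n : ℕ} (h : H1coeff r n ≠ 0) :
    ∃ a b : ℕ, a ^ 2 * b ^ 3 = n := by
  have hn : n ≠ 0 := by rintro rfl; simp at h
  refine Nat.exists_sq_mul_cube_eq hn fun p hp h1 => h ?_
  rw [(isMultiplicative_H1coeff (by omega)).multiplicative_factorization _ hn, Finsupp.prod]
  refine Finset.prod_eq_zero (i := p) (Finsupp.mem_support_iff.2 (by omega)) ?_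
  rw [h1, pow_one, H1coeff_prime hr hp]

theorem summable_norm_H1coeff_mul_rpow (hr : 2 ≤ r) {σ : ℝ} (hσ : 1 / 2 < σ) :
    Summable fun n : ℕ => ‖H1coeff r n‖ * (n : ℝ) ^ (-σ) := by
  have hT : Summable fun x : ℕ × ℕ => (x.1 : ℝ) ^ (-(2 * σ)) * (x.2 : ℝ) ^ (-(3 * σ)) :=
    (Real.summable_nat_rpow.2 (by linarith)).mul_of_nonneg
      (Real.summable_nat_rpow.2 (by linarith)) (fun _ => by positivity) fun _ => by positivity
  set S : Set ℕ := {n | ∃ a b : ℕ, a ^ 2 * b ^ 3 = n} with hS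
  choose a b hab using fun n : S => n.2
  have hinj : Function.Injective fun n : S => (a n, b n) := fun m n h => by
    simp only [Prod.mk.injEq] at h
    exact Subtype.ext (by rw [← hab m, ← hab n, h.1, h.2])
  have hsub : Summable (S.indicator fun n : ℕ => (n : ℝ) ^ (-σ)) := by
    rw [← summable_subtype_iff_indicator]
    refine (hT.comp_injective hinj).congr fun n => ?_
    simp only [Function.comp_apply]
    rw [← hab n]
    push_cast
    rw [Real.mul_rpow (by positivity) (by positivity), ← Real.rpow_natCast_mul (by positivity),
      ← Real.rpow_natCast_mul (by positivity)]
    congr 2 <;> push_cast <;> ring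
  refine hsub.of_nonneg_of_le (fun _ => by positivity) fun n => ?_
  by_cases h : H1coeff r n = 0
  · rw [h, norm_zero, zero_mul]
    exact Set.indicator_nonneg (fun _ _ => by positivity) _
  · rw [Set.indicator_of_mem (show n ∈ S from exists_sq_mul_cube_of_H1coeff_ne_zero hr h)]
    exact mul_le_of_le_one_left (by positivity) (norm_H1coeff_le hr n)

theorem LSeriesSummable_H1coeff (hr : 2 ≤ r) {s : ℂ} (hs : 1 / 2 < s.re) :
    LSeriesSummable (H1coeff r) s := by
  refine Summable.of_norm_bounded (summable_norm_H1coeff_mul_rpow hr hs) fun n => ?_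
  rw [LSeries.norm_term_eq]
  split_ifs
  · positivity
  · rw [Real.rpow_neg (by positivity), div_eq_mul_inv]

theorem abscissaOfAbsConv_H1coeff_le (hr : 2 ≤ r) :
    LSeries.abscissaOfAbsConv (H1coeff r) ≤ ((1 / 2 : ℝ) : EReal) :=
  LSeries.abscissaOfAbsConv_le_of_forall_lt_LSeriesSummable fun _ hy =>
    LSeriesSummable_H1coeff hr (by simpa using hy)

theorem hasSum_H1coeff_prime_pow (hr : 2 ≤ r) {p : ℕ} (hp : p.Prime) {z : ℂ} (hz : ‖z‖ < 1) :
    HasSum (fun e : ℕ => H1coeff r (p ^ e) * z ^ e) ((1 - z) * (1 + z * (1 - z ^ r)⁻¹)) := by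
  have hr0 : r ≠ 0 := by omega
  set g := cardDivisorsCeilRoot r * (ArithmeticFunction.moebius : ArithmeticFunction ℂ) with hg
  have hgm : g.IsMultiplicative :=
    isMultiplicative_mul_moebius (isMultiplicative_cardDivisorsCeilRoot hr0)
  have hzr : ‖z ^ r‖ < 1 := by
    rw [norm_pow]
    exact pow_lt_one₀ (norm_nonneg _) hz hr0
  have h1 : HasSum (fun k : ℕ => (if r ∣ k then (1 : ℂ) else 0) * z ^ k) (1 - z ^ r)⁻¹ := by
    have hinj : Function.Injective fun e : ℕ => r * e := mul_right_injective₀ hr0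
    rw [← hinj.hasSum_iff]
    · have : (fun k : ℕ => (if r ∣ k then (1 : ℂ) else 0) * z ^ k) ∘ (fun e : ℕ => r * e) =
          fun e : ℕ => (z ^ r) ^ e := by
        ext e
        simp [pow_mul]
      rw [this]
      exact hasSum_geometric_of_norm_lt_one hzr
    · intro k hk
      rw [if_neg, zero_mul]
      rintro ⟨c, rfl⟩
      exact hk ⟨c, rfl⟩
  have h2 : HasSum (fun e : ℕ => g (p ^ (e + 1)) * z ^ (e + 1)) (z * (1 - z ^ r)⁻¹) := by
    refine (h1.mul_left z).congr_fun fun e => ?_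
    rw [hg, cardDivisorsCeilRoot_mul_moebius_prime_pow_succ hr0 hp]
    ring
  have h3 : HasSum (fun e : ℕ => g (p ^ e) * z ^ e) (1 + z * (1 - z ^ r)⁻¹) := by
    have := HasSum.zero_add (f := fun e : ℕ => g (p ^ e) * z ^ e) h2
    rwa [pow_zero, pow_zero, hgm.map_one, one_mul] at this
  have h4 : HasSum (fun e : ℕ => H1coeff r (p ^ (e + 1)) * z ^ (e + 1))
      (z * (1 - z ^ r)⁻¹ - z * (1 + z * (1 - z ^ r)⁻¹)) := by
    refine (h2.sub (h3.mul_left z)).congr_fun fun e => ?_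
    rw [H1coeff, ← hg, ArithmeticFunction.mul_moebius_prime_pow_succ _ hp]
    ring
  have h5 := HasSum.zero_add (f := fun e : ℕ => H1coeff r (p ^ e) * z ^ e) h4
  rw [pow_zero, pow_zero, (isMultiplicative_H1coeff hr0).map_one, one_mul] at h5
  rwa [show (1 - z) * (1 + z * (1 - z ^ r)⁻¹) =
    1 + (z * (1 - z ^ r)⁻¹ - z * (1 + z * (1 - z ^ r)⁻¹)) by ring]

end

section

variable {r : ℕ}

theorem LSeries_term_mul_of_coprime {f : ArithmeticFunction ℂ} (hf : f.IsMultiplicative) (s : ℂ)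
    {m n : ℕ} (h : m.Coprime n) :
    LSeries.term f s (m * n) = LSeries.term f s m * LSeries.term f s n := by
  rcases eq_or_ne m 0 with rfl | hm
  · simp
  rcases eq_or_ne n 0 with rfl | hn
  · simp
  rw [LSeries.term_of_ne_zero hm, LSeries.term_of_ne_zero hn,
    LSeries.term_of_ne_zero (mul_ne_zero hm hn), hf.map_mul_of_coprime h, Nat.cast_mul,
    Complex.natCast_mul_natCast_cpow]
  ring

theorem Nat.Prime.LSeries_term_pow {p : ℕ} (hp : p.Prime) (f : ArithmeticFunction ℂ) (s : ℂ)
    (e : ℕ) : LSeries.term f s (p ^ e) = f (p ^ e) * ((p : ℂ) ^ (-s)) ^ e := by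
  rw [LSeries.term_of_ne_zero (pow_ne_zero _ hp.ne_zero), Nat.cast_pow,
    ← Complex.natCast_cpow_natCast_mul, Complex.cpow_nat_mul, Complex.cpow_neg, inv_pow,
    div_eq_mul_inv]

theorem Nat.Prime.norm_cpow_neg_lt_one {p : ℕ} (hp : p.Prime) {s : ℂ} (hs : 0 < s.re) :
    ‖(p : ℂ) ^ (-s)‖ < 1 := by
  rw [Complex.norm_natCast_cpow_of_pos hp.pos]
  exact Real.rpow_lt_one_of_one_lt_of_neg (by exact_mod_cast hp.one_lt) (by simpa using hs)

theorem hasProd_LSeries_H1coeff (hr : 2 ≤ r) {s : ℂ} (hs : 1 / 2 < s.re) :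
    HasProd (fun p : Nat.Primes =>
      (1 - (p : ℂ) ^ (-s)) * (1 + (p : ℂ) ^ (-s) * (1 - ((p : ℂ) ^ (-s)) ^ r)⁻¹))
      (LSeries (H1coeff r) s) := by
  have hm := isMultiplicative_H1coeff (by omega : r ≠ 0)
  have h := EulerProduct.eulerProduct_hasProd (f := LSeries.term (H1coeff r) s)
    (by simp [LSeries.term_of_ne_zero, hm.map_one])
    (fun {m n} h => LSeries_term_mul_of_coprime hm s h)
    (LSeriesSummable_H1coeff hr hs).norm (LSeries.term_zero _ _)
  refine h.congr_fun fun p => ?_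
  rw [tsum_congr fun e => p.2.LSeries_term_pow (H1coeff r) s e]
  exact (hasSum_H1coeff_prime_pow hr p.2 (p.2.norm_cpow_neg_lt_one (by linarith))).tsum_eq.symm

theorem H1fun_eq_LSeries (hr : 2 ≤ r) {s : ℂ} (hs : 1 / 2 < s.re) :
    H1fun r s = LSeries (H1coeff r) s := by
  have hr' : (2 : ℝ) ≤ r := by exact_mod_cast hr
  have hs2 : 1 < (2 * s).re := by simp; linarith
  have hsr : 1 < ((r : ℂ) * s).re := by simp; nlinarith
  have hz2 := riemannZeta_ne_zero_of_one_lt_re hs2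
  have hzr := riemannZeta_ne_zero_of_one_lt_re hsr
  have hprod := ((hasProd_LSeries_H1coeff hr hs).mul
    ((riemannZeta_eulerProduct_hasProd hsr).inv₀ hzr)).mul (riemannZeta_eulerProduct_hasProd hs2)
  have hlocal : HasProd (fun p : Nat.Primes =>
      (1 - 1 / (((p : ℕ) : ℂ) ^ ((r : ℂ) * s) + ((p : ℕ) : ℂ) ^ (((r : ℂ) - 1) * s))))
      (LSeries (H1coeff r) s * (riemannZeta (r * s))⁻¹ * riemannZeta (2 * s)) := by
    refine hprod.congr_fun fun p => ?_
    have hp0 : ((p : ℕ) : ℂ) ≠ 0 := by exact_mod_cast p.2.ne_zero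
    have hz := p.2.norm_cpow_neg_lt_one (s := s) (by linarith)
    have hpr : ((p : ℕ) : ℂ) ^ (-(r * s)) = (((p : ℕ) : ℂ) ^ (-s)) ^ r := by
      rw [← Complex.cpow_nat_mul]; congr 1; ring
    have hp2 : ((p : ℕ) : ℂ) ^ (-(2 * s)) = (((p : ℕ) : ℂ) ^ (-s)) ^ 2 := by
      rw [← Complex.cpow_nat_mul]; congr 1; push_cast; ring
    have hq0 : ((p : ℕ) : ℂ) ^ (r * s) = ((((p : ℕ) : ℂ) ^ (-s)) ^ r)⁻¹ := by
      rw [← hpr, ← Complex.cpow_neg, neg_neg]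
    have hq1 : ((p : ℕ) : ℂ) ^ (((r : ℂ) - 1) * s) =
        ((((p : ℕ) : ℂ) ^ (-s)) ^ r)⁻¹ * ((p : ℕ) : ℂ) ^ (-s) := by
      rw [← hq0, ← Complex.cpow_add _ _ hp0]; congr 1; ring
    have hzne : ((p : ℕ) : ℂ) ^ (-s) ≠ 0 := by simp [Complex.cpow_eq_zero_iff, hp0]
    rw [hpr, hp2, hq0, hq1]
    generalize ((p : ℕ) : ℂ) ^ (-s) = z at hz hzne
    have hne {w : ℂ} (hw : ‖w‖ < 1) : 1 - w ≠ 0 := fun h => by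
      rw [← sub_eq_zero.1 h, norm_one] at hw
      exact lt_irrefl _ hw
    have h1 : 1 - z ≠ 0 := hne hz
    have h2 : 1 + z ≠ 0 := by simpa using hne (w := -z) (by simpa using hz)
    have h3 : 1 - z ^ r ≠ 0 := hne (by
      rw [norm_pow]; exact pow_lt_one₀ (norm_nonneg _) hz (by omega))
    have h4 : 1 - z ^ 2 = (1 - z) * (1 + z) := by ring
    have h5 : (z ^ r)⁻¹ + (z ^ r)⁻¹ * z = (z ^ r)⁻¹ * (1 + z) := by ring
    rw [h4, h5]
    have h6 := pow_ne_zero r hzne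
    generalize z ^ r = w at *
    field_simp
    ring
  rw [H1fun, hlocal.tprod_eq]
  generalize riemannZeta (2 * s) = a at hz2 ⊢
  generalize riemannZeta (r * s) = b at hzr ⊢
  field_simp

theorem H1fun_one (hr : 2 ≤ r) : H1fun r 1 = Cr1 r := by
  rw [H1fun, Cr1, mul_one, mul_one, riemannZeta_two]
  congr 1
  · field_simp
  · refine tprod_congr fun p => ?_
    rw [mul_one, Complex.cpow_natCast, ← Nat.cast_one, ← Nat.cast_sub (by omega),
      Complex.cpow_natCast]

theorem LSeries_H1coeff_one (hr : 2 ≤ r) : LSeries (H1coeff r) 1 = Cr1 r := by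
  rw [← H1fun_eq_LSeries hr (by norm_num), H1fun_one hr]

theorem abscissaOfAbsConv_H1coeff_lt_one (hr : 2 ≤ r) :
    LSeries.abscissaOfAbsConv (H1coeff r) < (1 : ℂ).re :=
  (abscissaOfAbsConv_H1coeff_le hr).trans_lt (by
    rw [Complex.one_re]; exact_mod_cast (by norm_num : (1 / 2 : ℝ) < 1))

theorem deriv_H1fun_one (hr : 2 ≤ r) :
    deriv (H1fun r) 1 = -LSeries (LSeries.logMul (H1coeff r)) 1 := by
  rw [← LSeries_deriv (abscissaOfAbsConv_H1coeff_lt_one hr)]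
  refine Filter.EventuallyEq.deriv_eq ?_
  have : {s : ℂ | 1 / 2 < s.re} ∈ nhds (1 : ℂ) :=
    (isOpen_lt continuous_const Complex.continuous_re).mem_nhds (by norm_num)
  filter_upwards [this] with s hs
  exact H1fun_eq_LSeries hr hs

theorem hasSum_H1coeff_div (hr : 2 ≤ r) :
    HasSum (fun m : ℕ => H1coeff r m / m) (Cr1 r) := by
  rw [← LSeries_H1coeff_one hr]
  refine (LSeriesSummable_H1coeff hr (by norm_num)).LSeriesHasSum.congr_fun fun m => ?_
  rcases eq_or_ne m 0 with rfl | hm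
  · simp
  · rw [LSeries.term_of_ne_zero hm, Complex.cpow_one]

theorem hasSum_H1coeff_mul_log_div (hr : 2 ≤ r) :
    HasSum (fun m : ℕ => H1coeff r m * (Real.log m : ℂ) / m) (-deriv (H1fun r) 1) := by
  rw [deriv_H1fun_one hr, neg_neg]
  refine (LSeriesSummable_logMul_of_lt_re
    (abscissaOfAbsConv_H1coeff_lt_one hr)).LSeriesHasSum.congr_fun fun m => ?_
  rcases eq_or_ne m 0 with rfl | hm
  · simp
  · rw [LSeries.term_of_ne_zero hm, Complex.cpow_one, LSeries.logMul, Complex.natCast_log,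
      mul_comm (H1coeff r m)]

theorem hasSum_sum_card_divisors_genMinPow (hr : 2 ≤ r) (x : ℝ) :
    HasSum (fun m : ℕ => H1coeff r m *
      ((∑ n ∈ Finset.Ioc 0 ⌊x / m⌋₊, ArithmeticFunction.sigma 0 n : ℕ) : ℂ))
      (∑ n ∈ Finset.Icc 1 ⌊x⌋₊, ((genMinPow r n).divisors.card : ℂ)) := by
  have h1 : ∑ n ∈ Finset.Icc 1 ⌊x⌋₊, ((genMinPow r n).divisors.card : ℂ) =
      ∑ m ∈ Finset.Ioc 0 ⌊x⌋₊, H1coeff r m *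
        ((∑ n ∈ Finset.Ioc 0 ⌊x / m⌋₊, ArithmeticFunction.sigma 0 n : ℕ) : ℂ) := by
    calc _ = ∑ n ∈ Finset.Ioc 0 ⌊x⌋₊, cardDivisorsCeilRoot r n := by
          refine Finset.sum_congr rfl fun n hn => ?_
          rw [Finset.mem_Ioc] at hn
          rw [genMinPow_eq_ceilRoot (by omega) (by omega), cardDivisorsCeilRoot_apply]
      _ = _ := by
          rw [← H1coeff_mul_sigma_zero, ArithmeticFunction.sum_Ioc_mul_eq_sum_sum]
          refine Finset.sum_congr rfl fun m _ => ?_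
          rw [Nat.floor_div_natCast]
          simp
  rw [h1]
  refine hasSum_sum_of_ne_finset_zero fun m hm => ?_
  rw [Finset.mem_Ioc, not_and_or, not_lt, not_le] at hm
  rcases hm with hm | hm
  · simp [Nat.le_zero.1 hm]
  · rw [Nat.floor_div_natCast, Nat.div_eq_of_lt hm]
    simp

theorem exists_norm_sum_card_divisors_genMinPow_sub_le (hr : 2 ≤ r) {θ : ℝ} (hθ : 1 / 2 < θ)
    (hθ1 : θ < 1) : ∃ C : ℝ, ∀ x : ℝ, 0 < x →
      ‖(∑ n ∈ Finset.Icc 1 ⌊x⌋₊, ((genMinPow r n).divisors.card : ℂ)) -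
        (Cr1 r * x * Real.log x +
          (deriv (H1fun r) 1 + (2 * (Real.eulerMascheroniConstant : ℂ) - 1) * Cr1 r) * x)‖ ≤
        C * x ^ θ := by
  obtain ⟨C, hC⟩ := exists_abs_sum_sigma_zero_sub_le_rpow hθ.le hθ1
  have hsum := summable_norm_H1coeff_mul_rpow hr hθ
  refine ⟨C * ∑' m : ℕ, ‖H1coeff r m‖ * (m : ℝ) ^ (-θ), fun x hx => ?_⟩
  set c : ℝ := 2 * Real.eulerMascheroniConstant - 1 with hc
  have hmain := (((hasSum_H1coeff_div hr).mul_left ((x * Real.log x + c * x : ℝ) : ℂ)).sub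
    ((hasSum_H1coeff_mul_log_div hr).mul_left (x : ℂ)))
  have herr := (hasSum_sum_card_divisors_genMinPow hr x).sub hmain
  have hbound : ∀ m : ℕ, ‖H1coeff r m *
      ((∑ n ∈ Finset.Ioc 0 ⌊x / m⌋₊, ArithmeticFunction.sigma 0 n : ℕ) : ℂ) -
      (((x * Real.log x + c * x : ℝ) : ℂ) * (H1coeff r m / m) -
        x * (H1coeff r m * (Real.log m : ℂ) / m))‖ ≤
      C * x ^ θ * (‖H1coeff r m‖ * (m : ℝ) ^ (-θ)) := by
    intro m
    rcases eq_or_ne m 0 with rfl | hm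
    · simp
    have hm' : (0 : ℝ) < m := by exact_mod_cast Nat.pos_of_ne_zero hm
    have h := hC (x / m) (by positivity)
    rw [Real.log_div hx.ne' hm'.ne'] at h
    set D : ℕ := ∑ n ∈ Finset.Ioc 0 ⌊x / m⌋₊, ArithmeticFunction.sigma 0 n
    have heq : H1coeff r m * (D : ℂ) - (((x * Real.log x + c * x : ℝ) : ℂ) * (H1coeff r m / m) -
        x * (H1coeff r m * (Real.log m : ℂ) / m)) = H1coeff r m *
        (((D : ℝ) - (x / m * (Real.log x - Real.log m) + c * (x / m)) : ℝ) : ℂ) := by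
      push_cast
      ring
    rw [heq, norm_mul, Complex.norm_real, Real.norm_eq_abs]
    refine (mul_le_mul_of_nonneg_left h (norm_nonneg _)).trans (le_of_eq ?_)
    rw [Real.div_rpow hx.le hm'.le, Real.rpow_neg hm'.le]
    ring
  have hle := tsum_of_norm_bounded (hsum.hasSum.mul_left (C * x ^ θ)) hbound
  rw [herr.tsum_eq] at hle
  refine (le_of_eq ?_).trans (hle.trans (le_of_eq ?_))
  · congr 2
    rw [hc]
    push_cast
    ring
  · ring

end

theorem unweighted_mean_value (r : ℕ) (hr : 2 ≤ r) (ε : ℝ) (hε : 0 < ε) :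
    (fun x : ℝ =>
        (∑ n ∈ Finset.Icc 1 ⌊x⌋₊, ((genMinPow r n).divisors.card : ℂ)) -
        (Cr1 r * x * Real.log x +
          (deriv (H1fun r) 1 + (2 * (Real.eulerMascheroniConstant : ℂ) - 1) * Cr1 r) * x))
      =O[atTop] fun x : ℝ => x ^ ((1 : ℝ) / 2 + ε) := by
  set θ : ℝ := min (1 / 2 + ε) (3 / 4) with hθ
  have h1 : 1 / 2 < θ := lt_min (by linarith) (by norm_num)
  have h2 : θ < 1 := (min_le_right _ _).trans_lt (by norm_num)
  obtain ⟨C, hC⟩ := exists_norm_sum_card_divisors_genMinPow_sub_le hr h1 h2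
  refine (IsBigO.of_bound C (g := fun x : ℝ => x ^ θ) ?_).trans (IsBigO.of_bound 1 ?_)
  · filter_upwards [eventually_gt_atTop 0] with x hx
    rw [Real.norm_of_nonneg (Real.rpow_nonneg hx.le _)]
    exact hC x hx
  · filter_upwards [eventually_ge_atTop 1] with x hx
    have hx0 : 0 ≤ x := by linarith
    rw [one_mul, Real.norm_of_nonneg (Real.rpow_nonneg hx0 _),
      Real.norm_of_nonneg (Real.rpow_nonneg hx0 _)]
    exact Real.rpow_le_rpow_of_exponent_le hx (min_le_left _ _)
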